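/- arXiv:2507.22852 — 2 statements merged into one kernel-verified Lean document; each statement's English description precedes it below -/
import Mathlib

section
/- The optimal wage policy F* is continuous as a function on [0,∞) if and only if D is strictly increasing on [0,1]. -/
open MeasureTheory Set Filter

noncomputable section

namespace Career

/-- Right-continuous CDF of a wage policy: `F(w) = F([0,w])`. -/
def cdf (F : Measure ℝ) (w : ℝ) : ℝ := (F (Iic w)).toReal

/-- Left limit `F(w⁻)` of the CDF of a measure. -/
def cdfLeft (F : Measure ℝ) (w : ℝ) : ℝ := (F (Iio w)).toReal

/-- A wage policy: a Borel probability measure on `[0, ∞)`. -/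
def IsWagePolicy (F : Measure ℝ) : Prop :=
  IsProbabilityMeasure F ∧ F (Iio 0) = 0

/-- An equilibrium `(σ, q)` of the game induced by the wage policy `F`:
`σ` is measurable with values in `[0,1]`, `q = ∫ σ dF`, and for every wage `w ≥ 0`
the worker works (`σ w = 1`) whenever `w + D q > λ` and shirks (`σ w = 0`)
whenever `w + D q < λ`. -/
def IsEquilibrium (D : ℝ → ℝ) (lam : ℝ) (F : Measure ℝ) (σ : ℝ → ℝ) (q : ℝ) : Prop :=
  Measurable σ ∧ (∀ w, σ w ∈ Icc (0:ℝ) 1) ∧ q = ∫ w, σ w ∂F ∧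
    ∀ w, 0 ≤ w → (lam < w + D q → σ w = 1) ∧ (w + D q < lam → σ w = 0)

/-- `q` is an equilibrium working probability of the wage policy `F`. -/
def EqWorkProb (D : ℝ → ℝ) (lam : ℝ) (F : Measure ℝ) (q : ℝ) : Prop :=
  ∃ σ : ℝ → ℝ, IsEquilibrium D lam F σ q

/-- `F` fully implements full working. -/
def FullyImplements (D : ℝ → ℝ) (lam : ℝ) (F : Measure ℝ) : Prop :=
  EqWorkProb D lam F 1 ∧ ∀ q, EqWorkProb D lam F q → q = 1

/-- The partially optimal wage `w_ = λ - D(1)`. -/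
def wLow (D : ℝ → ℝ) (lam : ℝ) : ℝ := lam - D 1

/-- The robustly optimal deterministic wage `w̄ = λ - min_{q ∈ [0,1]} D(q)`. -/
def wHigh (D : ℝ → ℝ) (lam : ℝ) : ℝ := lam - sInf (D '' Icc 0 1)

/-- `q̄(w)`: the largest `q ∈ [0,1]` with `w + D(q) = λ`. -/
def qbar (D : ℝ → ℝ) (lam : ℝ) (w : ℝ) : ℝ :=
  sSup {q | q ∈ Icc (0:ℝ) 1 ∧ w + D q = lam}

/-- The optimal wage policy `F*` (as a CDF). -/
def Fstar (D : ℝ → ℝ) (lam : ℝ) (w : ℝ) : ℝ :=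
  if w < wLow D lam then 0
  else if w < wHigh D lam then 1 - Function.rightLim (qbar D lam) w
  else 1

/-- The equilibrium-keeping constraint (EK) for a CDF `f`. -/
def EK (D : ℝ → ℝ) (lam : ℝ) (f : ℝ → ℝ) : Prop :=
  ∀ w, w < wLow D lam → f w = 0

/-- The equilibrium-breaking constraint (EB) for a CDF given as a function `f`. -/
def EBfun (D : ℝ → ℝ) (lam : ℝ) (f : ℝ → ℝ) : Prop :=
  ∀ q ∈ Ico (0:ℝ) 1, ∀ w, 0 ≤ w →
    Function.leftLim f w ≤ 1 - q → 1 - q ≤ f w → lam ≤ w + D q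

/-- The equilibrium-breaking constraint (EB) for the CDF of a measure `F`. -/
def EBmeas (D : ℝ → ℝ) (lam : ℝ) (F : Measure ℝ) : Prop :=
  ∀ q ∈ Ico (0:ℝ) 1, ∀ w, 0 ≤ w →
    cdfLeft F w ≤ 1 - q → 1 - q ≤ cdf F w → lam ≤ w + D q

end Career

namespace Career

variable {D : ℝ → ℝ} {lam : ℝ}

/-- The working probabilities in `[0,1]` at which shirking is strictly optimal at wage `w`. -/
def shirkSet (D : ℝ → ℝ) (lam w : ℝ) : Set ℝ := {q | q ∈ Icc (0:ℝ) 1 ∧ D q < lam - w}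

theorem bddAbove_shirkSet (D : ℝ → ℝ) (lam w : ℝ) : BddAbove (shirkSet D lam w) :=
  ⟨1, fun _ hq => hq.1.2⟩

theorem sSup_shirkSet_mem_Icc (D : ℝ → ℝ) (lam w : ℝ) :
    sSup (shirkSet D lam w) ∈ Icc (0:ℝ) 1 :=
  ⟨Real.sSup_nonneg fun _ hq => hq.1.1, Real.sSup_le (fun _ hq => hq.1.2) zero_le_one⟩

theorem antitone_sSup_shirkSet (D : ℝ → ℝ) (lam : ℝ) :
    Antitone fun w => sSup (shirkSet D lam w) := by
  intro w w' h
  exact Real.sSup_le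
    (fun q hq => le_csSup (bddAbove_shirkSet D lam w) ⟨hq.1, hq.2.trans_le (by linarith)⟩)
    (sSup_shirkSet_mem_Icc D lam w).1

theorem bddBelow_image (hD : ContinuousOn D (Icc 0 1)) : BddBelow (D '' Icc 0 1) :=
  (isCompact_Icc.image_of_continuousOn hD).bddBelow

theorem shirkSet_eq_empty (hD : ContinuousOn D (Icc 0 1)) {w : ℝ} (hw : wHigh D lam ≤ w) :
    shirkSet D lam w = ∅ := by
  refine eq_empty_of_forall_notMem fun q hq => ?_
  have h1 := csInf_le (bddBelow_image hD) (mem_image_of_mem D hq.1)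
  have h2 := hq.2
  unfold wHigh at hw
  linarith

theorem shirkSet_nonempty {w : ℝ} (hw : w < wHigh D lam) : (shirkSet D lam w).Nonempty := by
  have hne : (D '' Icc (0:ℝ) 1).Nonempty := (nonempty_Icc.2 zero_le_one).image D
  obtain ⟨_, ⟨q, hq, rfl⟩, h⟩ :=
    exists_lt_of_csInf_lt hne (show sInf (D '' Icc 0 1) < lam - w by unfold wHigh at hw; linarith)
  exact ⟨q, hq, h⟩

theorem sSup_shirkSet_of_one_mem {w : ℝ} (h : D 1 < lam - w) :
    sSup (shirkSet D lam w) = 1 :=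
  le_antisymm (sSup_shirkSet_mem_Icc D lam w).2
    (le_csSup (bddAbove_shirkSet D lam w) ⟨right_mem_Icc.2 zero_le_one, h⟩)

theorem le_qbar {q w : ℝ} (hq : q ∈ Icc (0:ℝ) 1) (h : w + D q = lam) : q ≤ qbar D lam w :=
  le_csSup ⟨1, fun _ hp => hp.1.2⟩ ⟨hq, h⟩

theorem le_qbar_of_mem_shirkSet (hD : ContinuousOn D (Icc 0 1)) {q w : ℝ}
    (hq : q ∈ shirkSet D lam w) (hw : wLow D lam ≤ w) : q ≤ qbar D lam w := by
  obtain ⟨p, hp, hpw⟩ := intermediate_value_Icc hq.1.2 (hD.mono (Icc_subset_Icc_left hq.1.1))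
    (show lam - w ∈ Icc (D q) (D 1) from ⟨hq.2.le, by unfold wLow at hw; linarith⟩)
  exact hp.1.trans (le_qbar ⟨hq.1.1.trans hp.1, hp.2⟩ (by linarith))

theorem tendsto_qbar_nhdsGT (hD : ContinuousOn D (Icc 0 1)) {w : ℝ} (h1 : wLow D lam ≤ w)
    (h2 : w < wHigh D lam) :
    Tendsto (qbar D lam) (nhdsWithin w (Ioi w)) (nhds (sSup (shirkSet D lam w))) := by
  refine tendsto_order.2 ⟨fun a ha => ?_, fun a ha => ?_⟩
  · obtain ⟨q, hq, haq⟩ := exists_lt_of_lt_csSup (shirkSet_nonempty h2) ha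
    filter_upwards [Ioo_mem_nhdsGT (show w < lam - D q by have := hq.2; linarith)] with x hx
    exact haq.trans_le (le_qbar_of_mem_shirkSet hD ⟨hq.1, by linarith [hx.2]⟩ (h1.trans hx.1.le))
  · filter_upwards [self_mem_nhdsWithin] with x hx
    refine lt_of_le_of_lt (Real.sSup_le (fun q hq => ?_) (sSup_shirkSet_mem_Icc D lam w).1) ha
    exact le_csSup (bddAbove_shirkSet D lam w)
      ⟨hq.1, by have := hq.2; have := mem_Ioi.1 hx; linarith⟩

theorem Fstar_eq (hD : ContinuousOn D (Icc 0 1)) (w : ℝ) :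
    Fstar D lam w = 1 - sSup (shirkSet D lam w) := by
  unfold Fstar
  split_ifs with h1 h2
  · rw [sSup_shirkSet_of_one_mem (by unfold wLow at h1; linarith), sub_self]
  · rw [rightLim_eq_of_tendsto (tendsto_qbar_nhdsGT hD (not_lt.1 h1) h2)]
  · rw [shirkSet_eq_empty hD (not_lt.1 h2), Real.sSup_empty, sub_zero]

theorem sSup_shirkSet_sub_of_strictMonoOn (hD : StrictMonoOn D (Icc 0 1)) {q : ℝ}
    (hq : q ∈ Icc (0:ℝ) 1) : sSup (shirkSet D lam (lam - D q)) = q := by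
  have hset : shirkSet D lam (lam - D q) = Ico 0 q := by
    ext p
    simp only [shirkSet, mem_ofPred_eq, sub_sub_cancel, mem_Ico]
    refine ⟨fun h => ⟨h.1.1, (hD.lt_iff_lt h.1 hq).1 h.2⟩, fun h => ?_⟩
    have hp : p ∈ Icc (0:ℝ) 1 := ⟨h.1, h.2.le.trans hq.2⟩
    exact ⟨hp, hD hp hq h.2⟩
  rw [hset]
  rcases hq.1.eq_or_lt with rfl | h
  · simp
  · exact csSup_Ico h

theorem continuous_sSup_shirkSet_of_strictMonoOn (hD : StrictMonoOn D (Icc 0 1)) :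
    Continuous fun w => sSup (shirkSet D lam w) := by
  let f : ℝ → Icc (0:ℝ) 1 := fun w => ⟨sSup (shirkSet D lam (-w)), sSup_shirkSet_mem_Icc D lam _⟩
  have hf : Continuous f := by
    refine Monotone.continuous_of_surjective
      (fun a b h => antitone_sSup_shirkSet D lam (neg_le_neg h)) fun q => ⟨-(lam - D q), ?_⟩
    exact Subtype.ext (by simpa [f] using sSup_shirkSet_sub_of_strictMonoOn (lam := lam) hD q.2)
  have := continuous_subtype_val.comp (hf.comp continuous_neg)
  simpa [f, Function.comp_def] using this

theorem apply_sSup_shirkSet (hD : ContinuousOn D (Icc 0 1)) {w : ℝ}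
    (h : sSup (shirkSet D lam w) ∈ Ioo (0:ℝ) 1) : D (sSup (shirkSet D lam w)) = lam - w := by
  set q := sSup (shirkSet D lam w) with hq
  have hc : ContinuousAt D q := hD.continuousAt (Icc_mem_nhds h.1 h.2)
  refine le_antisymm (not_lt.1 fun hlt => ?_) (not_lt.1 fun hlt => ?_)
  · obtain ⟨l, hl, hl'⟩ := exists_Ioc_subset_of_mem_nhds (hc.eventually_const_lt hlt) ⟨0, h.1⟩
    have hne : (shirkSet D lam w).Nonempty := by
      by_contra he
      rw [not_nonempty_iff_eq_empty.1 he, Real.sSup_empty] at hq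
      exact h.1.ne' hq
    obtain ⟨p, hp, hlp⟩ := exists_lt_of_lt_csSup hne hl
    exact lt_asymm hp.2 (hl' ⟨hlp, le_csSup (bddAbove_shirkSet D lam w) hp⟩)
  · obtain ⟨p, ⟨hp, hp1⟩, hqp⟩ := ((((hc.eventually_lt_const hlt).and
      (eventually_lt_nhds h.2)).filter_mono nhdsWithin_le_nhds).and
      (self_mem_nhdsWithin : Ioi q ∈ nhdsWithin q (Ioi q))).exists
    exact (mem_Ioi.1 hqp).not_ge
      (le_csSup (bddAbove_shirkSet D lam w) ⟨⟨h.1.le.trans (mem_Ioi.1 hqp).le, hp1.le⟩, hp⟩)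

theorem strictMonoOn_Icc_of_continuousOn (hD : ContinuousOn D (Icc 0 1))
    (h : StrictMonoOn D (Ioc 0 1)) : StrictMonoOn D (Icc 0 1) := by
  intro p hp q hq hpq
  rcases hp.1.eq_or_lt with rfl | hp0
  · have hm : q / 2 ∈ Ioc (0:ℝ) 1 := ⟨by linarith, by linarith [hq.2]⟩
    refine lt_of_le_of_lt ?_ (h hm ⟨hpq, hq.2⟩ (by linarith))
    have ht : Tendsto D (nhdsWithin 0 (Ioi 0)) (nhds (D 0)) :=
      (hD 0 hp).mono_left (nhdsWithin_le_of_mem (Icc_mem_nhdsGT zero_lt_one))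
    refine le_of_tendsto ht ?_
    filter_upwards [Ioo_mem_nhdsGT hm.1] with x hx
    exact (h ⟨hx.1, hx.2.le.trans hm.2⟩ hm hx.2).le
  · exact h ⟨hp0, hp.2⟩ ⟨hp0.trans hpq, hq.2⟩ hpq

theorem strictMonoOn_of_continuousOn_sSup_shirkSet (hD : ContinuousOn D (Icc 0 1))
    (hlam : ∀ q ∈ Icc (0:ℝ) 1, D q < lam)
    (hc : ContinuousOn (fun w => sSup (shirkSet D lam w)) (Ici 0)) :
    StrictMonoOn D (Icc 0 1) := by
  have h1 : (1:ℝ) ∈ Icc (0:ℝ) 1 := right_mem_Icc.2 zero_le_one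
  have hW : 0 ≤ wHigh D lam := by
    have := csInf_le (bddBelow_image hD) (mem_image_of_mem D h1)
    have := hlam 1 h1
    unfold wHigh
    linarith
  have hex : ∀ q ∈ Ioo (0:ℝ) 1, ∃ w, sSup (shirkSet D lam w) = q ∧ D q = lam - w := by
    intro q hq
    obtain ⟨w, -, hw⟩ := intermediate_value_Icc' hW (hc.mono Icc_subset_Ici_self)
      (show q ∈ Icc (sSup (shirkSet D lam (wHigh D lam))) (sSup (shirkSet D lam 0)) by
        rw [shirkSet_eq_empty hD le_rfl, Real.sSup_empty,
          sSup_shirkSet_of_one_mem (by simpa using hlam 1 h1)]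
        exact Ioo_subset_Icc_self hq)
    dsimp only at hw
    subst hw
    exact ⟨w, rfl, apply_sSup_shirkSet hD hq⟩
  have hle : ∀ p ∈ Ioo (0:ℝ) 1, ∀ q ∈ Icc (0:ℝ) 1, p < q → D p ≤ D q := by
    intro p hp q hq hpq
    obtain ⟨w, rfl, hDp⟩ := hex p hp
    rw [hDp]
    exact not_lt.1 fun h => hpq.not_ge (le_csSup (bddAbove_shirkSet D lam w) ⟨hq, h⟩)
  refine strictMonoOn_Icc_of_continuousOn hD fun p hp q hq hpq => ?_
  have hp' : p ∈ Ioo (0:ℝ) 1 := ⟨hp.1, hpq.trans_le hq.2⟩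
  obtain ⟨m, hpm, hmq⟩ := exists_between hpq
  have hm : m ∈ Ioo (0:ℝ) 1 := ⟨hp.1.trans hpm, hmq.trans_le hq.2⟩
  refine lt_of_lt_of_le (lt_of_le_of_ne (hle p hp' m (Ioo_subset_Icc_self hm) hpm) fun he => ?_)
    (hle m hm q (Ioc_subset_Icc_self hq) hmq)
  obtain ⟨v, hv, hDv⟩ := hex p hp'
  obtain ⟨w, hw, hDw⟩ := hex m hm
  have hvw : v = w := by linarith
  exact hpm.ne (hv.symm.trans (hvw ▸ hw))

end Career

open Career in
/-- The optimal wage policy `F*` is continuous as a function on `[0,∞)`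
if and only if `D` is strictly increasing on `[0,1]`. -/
theorem statement1 (D : ℝ → ℝ) (lam : ℝ)
    (hD : ContinuousOn D (Icc 0 1))
    (hlam : ∀ q ∈ Icc (0:ℝ) 1, D q < lam) :
    ContinuousOn (Fstar D lam) (Ici 0) ↔ StrictMonoOn D (Icc 0 1) := by
  have hF : Fstar D lam = fun w => 1 - sSup (shirkSet D lam w) := funext (Fstar_eq hD)
  rw [hF]
  refine ⟨fun h => strictMonoOn_of_continuousOn_sSup_shirkSet hD hlam ?_, fun h => ?_⟩
  · exact ((continuousOn_const (c := (1:ℝ))).sub h).congr fun w _ => (sub_sub_cancel _ _).symm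
  · exact (continuous_const.sub (continuous_sSup_shirkSet_of_strictMonoOn h)).continuousOn
end
end

section
/- The point mass δ_{w_} admits an equilibrium working probability different from 1 if and only if there exists q ∈ [0,1) with D(q) ≤ D(1). -/
open MeasureTheory Set Filter

noncomputable section

namespace Career

/-- Under a point mass at a nonnegative wage, the equilibrium working probabilities are the values
at that wage of admissible best responses. -/
theorem eqWorkProb_dirac_iff {D : ℝ → ℝ} {lam w₀ q : ℝ} (hw₀ : 0 ≤ w₀) :
    EqWorkProb D lam (Measure.dirac w₀) q ↔
      q ∈ Icc (0:ℝ) 1 ∧ (lam < w₀ + D q → q = 1) ∧ (w₀ + D q < lam → q = 0) := by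
  constructor
  · rintro ⟨σ, -, hσ, hq, hbr⟩
    rw [integral_dirac] at hq
    have h := hbr w₀ hw₀
    rw [← hq] at h
    exact ⟨hq ▸ hσ w₀, h⟩
  · rintro ⟨hq, hwork, hshirk⟩
    refine ⟨fun w => if lam < w + D q then 1 else if w + D q < lam then 0 else q, ?_, ?_, ?_, ?_⟩
    · exact Measurable.ite (measurableSet_lt (by fun_prop) (by fun_prop)) measurable_const
        (Measurable.ite (measurableSet_lt (by fun_prop) (by fun_prop)) measurable_const
          measurable_const)
    · intro w
      dsimp only
      split_ifs
      · simp
      · simp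
      · exact hq
    · rw [integral_dirac]
      split_ifs with h₁ h₂
      · exact hwork h₁
      · exact hshirk h₂
      · rfl
    · intro w _
      refine ⟨fun h => if_pos h, fun h => ?_⟩
      simp only [if_neg h.not_gt, if_pos h]

end Career

open Career in
/-- The point mass `δ_{w_}` admits an equilibrium working probability
different from `1` iff there exists `q ∈ [0,1)` with `D(q) ≤ D(1)`. -/
theorem statement8 (D : ℝ → ℝ) (lam : ℝ)
    (hD : ContinuousOn D (Icc 0 1))
    (hlam : ∀ q ∈ Icc (0:ℝ) 1, D q < lam) :
    (∃ q, q ≠ 1 ∧ EqWorkProb D lam (Measure.dirac (wLow D lam)) q) ↔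
      ∃ q ∈ Ico (0:ℝ) 1, D q ≤ D 1 := by
  have hw : 0 ≤ wLow D lam := sub_nonneg.2 (hlam 1 (by simp)).le
  simp only [eqWorkProb_dirac_iff hw]
  unfold wLow
  constructor
  · rintro ⟨q, hq1, hq, hwork, -⟩
    refine ⟨q, ⟨hq.1, lt_of_le_of_ne hq.2 hq1⟩, ?_⟩
    by_contra! h
    exact hq1 (hwork (by linarith))
  · rintro ⟨q, ⟨hq0, hq1⟩, hDq⟩
    rcases le_total (D 0) (D 1) with h0 | h0
    · exact ⟨0, zero_ne_one, by simp, fun h => by linarith, fun _ => rfl⟩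
    · obtain ⟨p, hp, hDp⟩ := intermediate_value_Icc' hq0
        (hD.mono (Icc_subset_Icc_right hq1.le)) ⟨hDq, h0⟩
      exact ⟨p, (hp.2.trans_lt hq1).ne, ⟨hp.1, hp.2.trans hq1.le⟩,
        fun h => by linarith, fun h => by linarith⟩
end
end
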